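/- arXiv:1412.5781 — 2 statements merged into one kernel-verified Lean document; each statement's English description precedes it below -/
import Mathlib

section
/- Let p(X) be a set of sentences in the language L with parameters from a small set A and one second-order variable X for a subset of U^{|z|}. If p(X) is finitely consistent, i.e., for every finite conjunction φ(X) of formulas in p(X) there is D ⊆ U^{|z|} such that φ(D) holds in U, then there exists C ⊆ U^{|z|} such that every sentence of p(C) holds in U. -/
namespace Paper

open FirstOrder Language Cardinal Set

universe u

variable (L : FirstOrder.Language.{u, u}) (U : Type u) [iS : L.Structure U]

/-- A language consisting of a single `n`-ary relation symbol. -/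
def predLang (n : ℕ) : FirstOrder.Language.{u, u} where
  Functions := fun _ => PEmpty
  Relations := fun m => ULift (PLift (m = n))

/-- The language `L` together with one new `n`-ary relation symbol. -/
def expLang (n : ℕ) : FirstOrder.Language.{u, u} := L.sum (predLang n)

/-- The expansion `⟨U, D⟩` of `U` by a predicate for `D ⊆ U^n`. -/
def expStr {n : ℕ} (D : Set (Fin n → U)) : (expLang L n).Structure U where
  funMap := fun {_} f x =>
    match f with
    | Sum.inl f => Structure.funMap f x
    | Sum.inr f => f.elim
  RelMap := fun {_} r x =>
    match r with
    | Sum.inl r => Structure.RelMap r x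
    | Sum.inr h => (x ∘ Fin.cast h.down.down.symm) ∈ D

/-- Add the elements of `A : Set U` as constants to an arbitrary structure on `U`. -/
def addConsts {L' : FirstOrder.Language.{u, u}} (S : L'.Structure U) (A : Set U) :
    (L'[[↥A]]).Structure U :=
  letI := S
  letI : (constantsOn ↥A).Structure U := constantsOn.structure Subtype.val
  Language.sumStructure _ _ _

/-- Add all elements of `U` as constants to an arbitrary structure on `U`. -/
def addAllConsts {L' : FirstOrder.Language.{u, u}} (S : L'.Structure U) :
    (L'[[U]]).Structure U :=
  letI := S
  letI : (constantsOn U).Structure U := constantsOn.structure id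
  Language.sumStructure _ _ _

/-- Realization of a formula with respect to an explicitly given structure. -/
def FRealize {L' : FirstOrder.Language.{u, u}} (S : L'.Structure U) {α : Type*}
    (φ : L'.Formula α) (v : α → U) : Prop :=
  @Formula.Realize L' U S α φ v

/-- Realization of a sentence with respect to an explicitly given structure. -/
def SentRealize {L' : FirstOrder.Language.{u, u}} (S : L'.Structure U) (φ : L'.Sentence) : Prop :=
  @Sentence.Realize L' U S φ

/-- A structure on `U` is saturated if every type over a parameter set of cardinality `< #U`
which is finitely realized is realized. -/
def IsSatStr {L' : FirstOrder.Language.{u, u}} (S : L'.Structure U) : Prop :=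
  ∀ A : Set U, #A < #U → ∀ (m : ℕ) (p : Set ((L'[[↥A]]).Formula (Fin m))),
    (∀ s : Finset ((L'[[↥A]]).Formula (Fin m)), ↑s ⊆ p →
      ∃ b : Fin m → U, ∀ φ ∈ s, FRealize U (addConsts U S A) φ b) →
    ∃ b : Fin m → U, ∀ φ ∈ p, FRealize U (addConsts U S A) φ b

/-- `D ⊆ U^n` is saturated if the expansion `⟨U, D⟩` is a saturated structure. -/
def SatSet {n : ℕ} (D : Set (Fin n → U)) : Prop :=
  IsSatStr U (expStr L U D)

/-- `⟨U,C⟩ ≡_A ⟨U,D⟩` : the two expansions satisfy the same sentences with parameters in `A`. -/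
def EqvOver {n : ℕ} (A : Set U) (C D : Set (Fin n → U)) : Prop :=
  ∀ φ : ((expLang L n)[[↥A]]).Sentence,
    SentRealize U (addConsts U (expStr L U C) A) φ ↔
      SentRealize U (addConsts U (expStr L U D) A) φ

/-- `e(D/A)`, the class of all `C` with `⟨U,C⟩ ≡_A ⟨U,D⟩`. -/
def eSet {n : ℕ} (A : Set U) (D : Set (Fin n → U)) : Set (Set (Fin n → U)) :=
  {C | EqvOver L U A C D}

/-- The group `Aut(U/A)` of automorphisms of `U` fixing `A` pointwise (as a set). -/
def AutFix (A : Set U) : Set (U ≃[L] U) :=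
  {f | ∀ a ∈ A, f a = a}

/-- The image of a set of tuples under an automorphism. -/
def imgSet {n : ℕ} (f : U ≃[L] U) (D : Set (Fin n → U)) : Set (Fin n → U) :=
  (fun b => ⇑f ∘ b) '' D

/-- The orbit `o(D/A)` of `D` under `Aut(U/A)`. -/
def oSet {n : ℕ} (A : Set U) (D : Set (Fin n → U)) : Set (Set (Fin n → U)) :=
  {C | ∃ f ∈ AutFix L U A, imgSet L U f D = C}

/-- The orbit `o(b/A)` of a tuple `b` under `Aut(U/A)`. -/
def oTuple {n : ℕ} (A : Set U) (b : Fin n → U) : Set (Fin n → U) :=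
  {c | ∃ f ∈ AutFix L U A, ⇑f ∘ b = c}

/-- A family of sets shatters `B` if every subset of `B` is the trace of a member. -/
def Shatters {α : Type*} (u : Set (Set α)) (B : Set α) : Prop :=
  ∀ H ⊆ B, ∃ D ∈ u, D ∩ B = H

/-- A family of sets has finite VC dimension if for some `N` it shatters no `N`-element set. -/
def FiniteVC {α : Type*} (u : Set (Set α)) : Prop :=
  ∃ N : ℕ, ∀ B : Finset α, B.card = N → ¬Shatters u ↑B

/-- `B^{|z|}`, the set of tuples with coordinates in `B`. -/
def tuplesIn {n : ℕ} (B : Set U) : Set (Fin n → U) :=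
  {a | ∀ i, a i ∈ B}

/-- `φ(b, U)`, the set defined by `φ(x,z)` with `x ↦ b`. -/
def phiSet {m n : ℕ} (φ : L.Formula (Fin m ⊕ Fin n)) (b : Fin m → U) :
    Set (Fin n → U) :=
  {a | φ.Realize (Sum.elim b a)}

/-- `D` is approximable by `φ(x,z)` : every finite trace of `D` is the trace of
some instance `φ(b,U)`. -/
def ApproxBy {n : ℕ} (D : Set (Fin n → U)) {m : ℕ} (φ : L.Formula (Fin m ⊕ Fin n)) : Prop :=
  ∀ B : Finset U, ∃ b : Fin m → U,
    phiSet L U φ b ∩ tuplesIn U ↑B = D ∩ tuplesIn U ↑B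

/-- `D` is approximable from below by `φ(x,z)`. -/
def ApproxBelowBy {n : ℕ} (D : Set (Fin n → U)) {m : ℕ}
    (φ : L.Formula (Fin m ⊕ Fin n)) : Prop :=
  ∀ B : Finset U, ∃ b : Fin m → U,
    phiSet L U φ b ∩ tuplesIn U ↑B = D ∩ tuplesIn U ↑B ∧ phiSet L U φ b ⊆ D

/-- `D` is approximable from above by `φ(x,z)`. -/
def ApproxAboveBy {n : ℕ} (D : Set (Fin n → U)) {m : ℕ}
    (φ : L.Formula (Fin m ⊕ Fin n)) : Prop :=
  ∀ B : Finset U, ∃ b : Fin m → U,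
    phiSet L U φ b ∩ tuplesIn U ↑B = D ∩ tuplesIn U ↑B ∧ D ⊆ phiSet L U φ b

def Approximable {n : ℕ} (D : Set (Fin n → U)) : Prop :=
  ∃ (m : ℕ) (φ : L.Formula (Fin m ⊕ Fin n)), ApproxBy L U D φ

def ApproxBelow {n : ℕ} (D : Set (Fin n → U)) : Prop :=
  ∃ (m : ℕ) (φ : L.Formula (Fin m ⊕ Fin n)), ApproxBelowBy L U D φ

def ApproxAbove {n : ℕ} (D : Set (Fin n → U)) : Prop :=
  ∃ (m : ℕ) (φ : L.Formula (Fin m ⊕ Fin n)), ApproxAboveBy L U D φ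

/-- The formula `φ(x, a)` (an `L(U)`-formula in the variables `x`), obtained by
substituting the tuple `a` for the variables `z` in `φ(x,z)`. -/
def instFormula {m n : ℕ} (φ : L.Formula (Fin m ⊕ Fin n)) (a : Fin n → U) :
    (L[[U]]).Formula (Fin m) :=
  ((L.lhomWithConstants U).onFormula φ).subst
    (Sum.elim (fun i => Term.var i) (fun j => (L.con (a j)).term))

/-- A (complete) global type in the variables `x = (x_0, ..., x_{m-1})` : a maximal
finitely realized set of `L(U)`-formulas. -/
def IsGlobalType {m : ℕ} (p : Set ((L[[U]]).Formula (Fin m))) : Prop :=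
  (∀ s : Finset ((L[[U]]).Formula (Fin m)), ↑s ⊆ p →
    ∃ b : Fin m → U, ∀ φ ∈ s, FRealize U (addAllConsts U iS) φ b) ∧
  ∀ φ : (L[[U]]).Formula (Fin m), φ ∈ p ↔ φ.not ∉ p

/-- `D` is externally definable: `D = {a : φ(x,a) ∈ p}` for some global type `p` and
formula `φ(x,z)`. -/
def ExtDefinable {n : ℕ} (D : Set (Fin n → U)) : Prop :=
  ∃ (m : ℕ) (φ : L.Formula (Fin m ⊕ Fin n)) (p : Set ((L[[U]]).Formula (Fin m))),
    IsGlobalType L U p ∧ D = {a | instFormula L U φ a ∈ p}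

/-- A sequence of `n`-tuples is indiscernible with respect to the formulas of a
structure `S` on `U`. -/
def IndiscIn {L' : FirstOrder.Language.{u, u}} (S : L'.Structure U) {n : ℕ} {I : Type*} [LinearOrder I]
    (a : I → Fin n → U) : Prop :=
  ∀ (k : ℕ) (i j : Fin k → I), StrictMono i → StrictMono j →
    ∀ φ : L'.Formula (Fin k × Fin n),
      FRealize U S φ (fun q => a (i q.1) q.2) ↔ FRealize U S φ (fun q => a (j q.1) q.2)

/-- An `A`-indiscernible sequence of `n`-tuples. -/
def IndiscOver {n : ℕ} (A : Set U) {I : Type*} [LinearOrder I] (a : I → Fin n → U) : Prop :=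
  IndiscIn U (addConsts U iS A) a


/-- `D` is Lascar invariant over `A` : `D` is invariant over every small model containing `A`. -/
def LascarInv {n : ℕ} (A : Set U) (D : Set (Fin n → U)) : Prop :=
  ∀ M : L.ElementarySubstructure U, A ⊆ (M : L.Substructure U) →
    #((M : L.Substructure U) : Set U) < #U →
    ∀ f ∈ AutFix L U ((M : L.Substructure U) : Set U), imgSet L U f D = D

/-- The cardinality of the set `L(A)` of formulas with parameters in `A`. -/
def formulaCard (A : Set U) : Cardinal.{u} :=
  #(Σ k : ℕ, (L[[↥A]]).Formula (Fin k))

/-- `u` locally covers `B` (relative to the cardinal `κ`). -/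
def LocallyCovers {α : Type u} (κ : Cardinal.{u}) (u : Set (Set α)) (B : Set α) : Prop :=
  ∀ K : Set α, K ⊆ B → #K = κ → ∀ k : ℕ, ∃ D ∈ u, (k : Cardinal.{u}) ≤ #(↥(K ∩ D))

/-- `φ(x, b)` divides over `A` : for some infinite `K ⊆ o(b/A)` and some `k`,
`{φ(x,c) : c ∈ K}` is `k`-inconsistent. -/
def Divides {m n : ℕ} (φ : L.Formula (Fin m ⊕ Fin n)) (b : Fin n → U) (A : Set U) : Prop :=
  ∃ K : Set (Fin n → U), K ⊆ oTuple L U A b ∧ K.Infinite ∧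
    ∃ k : ℕ, ∀ s : Finset (Fin n → U), ↑s ⊆ K → s.card = k →
      ¬∃ x : Fin m → U, ∀ c ∈ s, φ.Realize (Sum.elim x c)

/-- `C` is pseudo-invariant over `A` : `e(C)` locally covers `o(b/A)` for every `b ∈ C`. -/
def PseudoInv {k : ℕ} (A : Set U) (C : Set (Fin k → U)) : Prop :=
  ∀ b ∈ C, LocallyCovers (#U) (eSet L U (∅ : Set U) C) (oTuple L U A b)

/-- A family `u` of subsets of `U^n` is closed: it is cut out by a set of sentences with a
second-order variable, i.e. sentences of the language expanded by a predicate. -/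
def ClosedFam {n : ℕ} (u : Set (Set (Fin n → U))) : Prop :=
  ∃ p : Set ((expLang L n).Sentence),
    u = {D | ∀ φ ∈ p, SentRealize U (expStr L U D) φ}

/-- `κ` is a Ramsey cardinal : every `2`-coloring of the finite subsets of a set of size `κ`
has a homogeneous set of size `κ`. -/
def IsRamseyCard (κ : Cardinal.{u}) : Prop :=
  ∀ (X : Type u), #X = κ → ∀ c : Finset X → Bool,
    ∃ H : Set X, #H = κ ∧
      ∀ s t : Finset X, ↑s ⊆ H → ↑t ⊆ H → s.card = t.card → c s = c t

/-- The formula `φ(x,z)` is NIP: the family of its instances `φ(a,U)` has finite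
VC dimension. -/
def FormulaNIP {m n : ℕ} (φ : L.Formula (Fin m ⊕ Fin n)) : Prop :=
  FiniteVC {E : Set (Fin n → U) | ∃ b : Fin m → U, E = phiSet L U φ b}

/-- The theory of `U` is NIP: every formula is NIP. -/
def TheoryNIP : Prop :=
  ∀ (m n : ℕ) (φ : L.Formula (Fin m ⊕ Fin n)), FormulaNIP L U φ

/-- A global type `p(z)` is invariant over `A` : each of the sets `D_{p,φ}` is fixed
(setwise) by every automorphism fixing `A` pointwise. -/
def GlobalTypeInv {n : ℕ} (A : Set U) (p : Set ((L[[U]]).Formula (Fin n))) : Prop :=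
  ∀ (k : ℕ) (φ : L.Formula (Fin n ⊕ Fin k)) (f : U ≃[L] U), f ∈ AutFix L U A →
    imgSet L U f {a | instFormula L U φ a ∈ p} = {a | instFormula L U φ a ∈ p}

/-- `M` (a subset of `U`) is `L(A;C)`-saturated : every finitely realized type `p(x) ⊆ L(A;C)`
is realized by a tuple from `M`. -/
def LACSat {n : ℕ} (C : Set (Fin n → U)) (A : Set U) (M : Set U) : Prop :=
  ∀ (m : ℕ) (p : Set (((expLang L n)[[↥A]]).Formula (Fin m))),
    (∀ s : Finset (((expLang L n)[[↥A]]).Formula (Fin m)), ↑s ⊆ p →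
      ∃ b : Fin m → U, ∀ φ ∈ s, FRealize U (addConsts U (expStr L U C) A) φ b) →
    ∃ b : Fin m → U, (∀ i, b i ∈ M) ∧
      ∀ φ ∈ p, FRealize U (addConsts U (expStr L U C) A) φ b

/-- The inclusion of languages `L(M) → L(U)` for `M : Set U`. -/
def liftConsts (M : Set U) : (L[[↥M]]) →ᴸ (L[[U]]) :=
  LHom.sumMap (LHom.id L) (LHom.constantsOnMap Subtype.val)


/-- The canonical inclusion of `L` into its expansion by an `n`-ary predicate. -/
abbrev inclExp (L : FirstOrder.Language.{u, u}) (n : ℕ) : L →ᴸ expLang L n :=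
  LHom.sumInl

/-- A set of formulas is jointly satisfied by some structure and some assignment. -/
def JointlySat {L' : FirstOrder.Language.{u, u}} {α : Type u} (S : Set (L'.Formula α)) : Prop :=
  ∃ (M : Type u) (_ : L'.Structure M) (_ : Nonempty M) (e : α → M), ∀ φ ∈ S, φ.Realize e

theorem JointlySat.mono {L' : FirstOrder.Language.{u, u}} {α : Type u}
    {S T : Set (L'.Formula α)} (hT : JointlySat T) (h : S ⊆ T) : JointlySat S := by
  obtain ⟨M, i, hM, e, he⟩ := hT
  exact ⟨M, i, hM, e, fun φ hφ => he φ (h hφ)⟩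

theorem JointlySat.of_finite {L' : FirstOrder.Language.{u, u}} {α : Type u}
    {S : Set (L'.Formula α)}
    (h : ∀ s : Finset (L'.Formula α), ↑s ⊆ S → JointlySat (s : Set (L'.Formula α))) :
    JointlySat S := by
  classical
  let T : L'[[α]].Theory := Formula.equivSentence '' S
  have hT : T.IsSatisfiable := by
    rw [Theory.isSatisfiable_iff_isFinitelySatisfiable]
    intro T0 hT0
    obtain ⟨s, hs, rfl⟩ := Finset.subset_set_image_iff.1 hT0
    obtain ⟨M, i, hM, e, he⟩ := h s hs
    let : (constantsOn α).Structure M := constantsOn.structure e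
    have : M ⊨ ((s.image Formula.equivSentence : Finset _) : L'[[α]].Theory) := by
      refine ⟨fun φ hφ => ?_⟩
      obtain ⟨χ, hχ, rfl⟩ := Finset.mem_image.1 (Finset.mem_coe.1 hφ)
      exact (Formula.realize_equivSentence M χ).2 (he χ hχ)
    exact Theory.Model.isSatisfiable M
  obtain ⟨M⟩ := hT
  let := (L'.lhomWithConstants α).reduct M
  refine ⟨M, inferInstance, inferInstance, fun a => (L'.con a : M), fun φ hφ => ?_⟩
  exact (Formula.realize_equivSentence M φ).1
    (Theory.realize_sentence_of_mem T (Set.mem_image_of_mem _ hφ))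

/-- The elementary diagram of `U`, as a set of formulas of the expanded language whose variables
are the elements of `U`. -/
def expDiag (L : FirstOrder.Language.{u, u}) (U : Type u) [L.Structure U] (n : ℕ) :
    Set ((expLang L n).Formula U) :=
  (inclExp L n).onFormula '' {θ | θ.Realize (id : U → U)}

/-- The Henkin formula `(∃ x, ψ(x)) → ψ(b)`. -/
noncomputable def henkin {L' : FirstOrder.Language.{u, u}} {U : Type u}
    (ψ : L'.Formula (U ⊕ Fin 1)) (b : U) : L'.Formula U :=
  (ψ.iExs (Fin 1)).imp (ψ.relabel (Sum.elim id fun _ => b))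

theorem realize_henkin {L' : FirstOrder.Language.{u, u}} {U M : Type u} [L'.Structure M]
    (ψ : L'.Formula (U ⊕ Fin 1)) (b : U) (e : U → M) :
    (henkin ψ b).Realize e ↔
      ((∃ m, ψ.Realize (Sum.elim e fun _ => m)) → ψ.Realize (Sum.elim e fun _ => e b)) := by
  have h1 : ((∃ i : Fin 1 → M, ψ.Realize (Sum.elim e i)) ↔
      ∃ m, ψ.Realize (Sum.elim e fun _ => m)) := by
    constructor
    · rintro ⟨i, hi⟩
      refine ⟨i 0, ?_⟩
      convert hi using 2
      funext j
      rw [Subsingleton.elim j 0]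
    · rintro ⟨m, hm⟩
      exact ⟨_, hm⟩
  have h2 : (e ∘ Sum.elim id fun _ : Fin 1 => b) = Sum.elim e fun _ => e b := by
    funext x
    rcases x with x | x <;> rfl
  rw [henkin, Formula.realize_imp, Formula.realize_iExs, Formula.realize_relabel, h1, h2]

theorem realize_congr_freeVars {L' : FirstOrder.Language.{u, u}} {α : Type u} [DecidableEq α]
    {M : Type u} [L'.Structure M] (φ : L'.Formula α) {v w : α → M}
    (h : ∀ a ∈ φ.freeVarFinset, v a = w a) : φ.Realize v ↔ φ.Realize w := by
  rw [Formula.Realize, Formula.Realize,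
    ← BoundedFormula.realize_restrictFreeVar (f := fun a => (a : α)) (v := v) w
      (fun a => h a a.2),
    BoundedFormula.realize_restrictFreeVar (f := fun a => (a : α)) (v := v) v (fun a => rfl)]

/-- If `e : U → M` preserves all formulas and `U` is saturated, the type of any `m : M` over the
image of a small set `B` is realized in `U`. -/
theorem IsSatStr.exists_realizing {L : FirstOrder.Language.{u, u}} {U : Type u}
    [iS : L.Structure U] (hsat : IsSatStr U iS) {B : Set U} (hB : #B < #U) {M : Type u}
    [L.Structure M] (e : U → M) (he : ∀ θ : L.Formula U, θ.Realize (id : U → U) → θ.Realize e)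
    (m : M) :
    ∃ b : U, ∀ χ : L.Formula (B ⊕ Fin 1),
      χ.Realize (Sum.elim (fun x : B => (x : U)) fun _ => b) →
        χ.Realize (Sum.elim (fun x : B => e x) fun _ => m) := by
  have key : ∀ (φ : (L[[↥B]]).Formula (Fin 1)) (b : Fin 1 → U),
      FRealize U (addConsts U iS B) φ b ↔
        Formula.Realize (L := L) (BoundedFormula.constantsVarsEquiv φ)
          (Sum.elim (fun x : B => (x : U)) b) := by
    intro φ b
    let : (constantsOn ↥B).Structure U := constantsOn.structure Subtype.val
    exact (@BoundedFormula.realize_constantsVarsEquiv L U _ _ _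
      (@Language.withConstantsStructure L U _ ↥B (constantsOn.structure Subtype.val))
      (LHom.sumInl_isExpansionOn U) 0 φ b default).symm
  obtain ⟨b, hb⟩ := hsat B hB 1
    {φ | Formula.Realize (L := L) (BoundedFormula.constantsVarsEquiv φ)
      (Sum.elim (fun x : B => e x) fun _ => m)} (by
    classical
    intro s hs
    let χ : L.Formula (B ⊕ Fin 1) :=
      Formula.iInf fun φ : s => (BoundedFormula.constantsVarsEquiv φ.1 : L.Formula (B ⊕ Fin 1))
    have hχ : χ.Realize (Sum.elim (fun x : B => e x) fun _ => m) :=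
      Formula.realize_iInf.2 fun φ => hs φ.2
    by_contra hcon
    have hno : Formula.Realize (Formula.iExs (Fin 1)
        (χ.relabel (Sum.map (fun x : B => (x : U)) id))).not (id : U → U) := by
      rw [Formula.realize_not, Formula.realize_iExs]
      rintro ⟨i, hi⟩
      rw [Formula.realize_relabel, Sum.elim_comp_map] at hi
      exact hcon ⟨i, fun φ hφ => (key φ i).2 (Formula.realize_iInf.1 hi ⟨φ, hφ⟩)⟩
    have := he _ hno
    rw [Formula.realize_not, Formula.realize_iExs] at this
    refine this ⟨fun _ => m, ?_⟩
    rw [Formula.realize_relabel, Sum.elim_comp_map]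
    exact hχ)
  refine ⟨b 0, fun χ hχ => ?_⟩
  by_contra hcon
  have h1 := hb (BoundedFormula.constantsVarsEquiv.symm χ.not) (by
    simpa using hcon)
  rw [key, Equiv.apply_symm_apply, Formula.realize_not] at h1
  refine h1 ?_
  convert hχ using 2
  funext j
  rw [Subsingleton.elim j 0]

theorem exists_extend_realize {L : FirstOrder.Language.{u, u}} {U M : Type u} [L.Structure U]
    [L.Structure M] {B : Set U} {b : U} (e : U → M) {m : M}
    (hb : ∀ χ : L.Formula (B ⊕ Fin 1),
      χ.Realize (Sum.elim (fun x : B => (x : U)) fun _ => b) →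
        χ.Realize (Sum.elim (fun x : B => e x) fun _ => m))
    (θ : L.Formula U) (hθ : θ.Realize (id : U → U)) :
    ∃ e' : U → M, (∀ x ∈ B, e' x = e x) ∧ e' b = m ∧ θ.Realize e' := by
  classical
  have hbB : b ∈ B → e b = m := by
    intro h
    have := hb (Term.equal (Term.var (Sum.inl ⟨b, h⟩)) (Term.var (Sum.inr 0))) (by simp)
    simpa using this
  let f : θ.freeVarFinset → (B ⊕ Fin 1) ⊕ θ.freeVarFinset := fun u =>
    if h : (u : U) ∈ B then Sum.inl (Sum.inl ⟨u, h⟩)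
    else if (u : U) = b then Sum.inl (Sum.inr 0) else Sum.inr u
  let χ : L.Formula (B ⊕ Fin 1) := Formula.iExs θ.freeVarFinset (θ.restrictFreeVar f)
  have hχ : χ.Realize (Sum.elim (fun x : B => (x : U)) fun _ => b) := by
    rw [Formula.realize_iExs]
    refine ⟨fun u => u, (BoundedFormula.realize_restrictFreeVar id ?_).2 hθ⟩
    intro u
    by_cases h : (u : U) ∈ B
    · simp [f, h]
    · by_cases h' : (u : U) = b
      · simp only [f, dif_neg h, if_pos h']
        exact h'.symm
      · simp [f, h, h']
  obtain ⟨i, hi⟩ := Formula.realize_iExs.1 (hb χ hχ)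
  let e' : U → M := fun u =>
    if u ∈ B then e u
    else if u = b then m else if h : u ∈ θ.freeVarFinset then i ⟨u, h⟩ else m
  refine ⟨e', fun x hx => if_pos hx, ?_, ?_⟩
  · by_cases h : b ∈ B
    · simp [e', h, hbB h]
    · simp [e', h]
  · refine (BoundedFormula.realize_restrictFreeVar e' ?_).1 hi
    intro u
    by_cases h : (u : U) ∈ B
    · simp [f, e', h]
    · by_cases h' : (u : U) = b
      · simp only [f, e', dif_neg h, if_neg h, if_pos h']
        rfl
      · simp [f, e', h, h']

theorem IsSatStr.exists_henkin_witness {L : FirstOrder.Language.{u, u}} {U : Type u}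
    [iS : L.Structure U] (hsat : IsSatStr U iS) (hU : ℵ₀ < #U) {n : ℕ}
    {S : Set ((expLang L n).Formula U)} (hS : #S < #U) (hP : JointlySat (S ∪ expDiag L U n))
    (ψ : (expLang L n).Formula (U ⊕ Fin 1)) :
    ∃ b, JointlySat (insert (henkin ψ b) S ∪ expDiag L U n) := by
  classical
  obtain ⟨M, iM, hM, e, he⟩ := hP
  let : L.Structure M := (inclExp L n).reduct M
  have hdiag : ∀ θ : L.Formula U, θ.Realize (id : U → U) → θ.Realize e := fun θ hθ =>
    (LHom.realize_onFormula (inclExp L n) θ).1 (he _ (Or.inr ⟨θ, hθ, rfl⟩))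
  let V : Set U := {u | Sum.inl u ∈ ψ.freeVarFinset}
  let B : Set U := (⋃ φ ∈ S, (φ.freeVarFinset : Set U)) ∪ V
  have hV : V.Finite := ψ.freeVarFinset.finite_toSet.preimage Sum.inl_injective.injOn
  have hB : #B < #U := by
    refine (mk_union_le _ _).trans_lt (add_lt_of_lt hU.le ?_ (hV.lt_aleph0.trans hU))
    refine (mk_biUnion_le _ _).trans_lt (mul_lt_of_lt hU.le hS ?_)
    refine lt_of_le_of_lt (ciSup_le' fun φ => ?_) hU
    exact (Finset.finite_toSet _).lt_aleph0.le
  obtain ⟨m, hm⟩ : ∃ m, (∃ m, ψ.Realize (Sum.elim e fun _ => m)) →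
      ψ.Realize (Sum.elim e fun _ => m) := by
    by_cases h : ∃ m, ψ.Realize (Sum.elim e fun _ => m)
    · exact h.imp fun m hm _ => hm
    · exact ⟨hM.some, fun h' => absurd h' h⟩
  obtain ⟨b, hb⟩ := hsat.exists_realizing hB e hdiag m
  refine ⟨b, JointlySat.of_finite fun s hs => ?_⟩
  have hex : ∀ φ : s, ∃ θ : L.Formula U, θ.Realize (id : U → U) ∧
      (φ.1 ∈ expDiag L U n → (inclExp L n).onFormula θ = φ.1) := by
    intro φ
    by_cases h : φ.1 ∈ expDiag L U n
    · obtain ⟨θ, hθ, h⟩ := h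
      exact ⟨θ, hθ, fun _ => h⟩
    · exact ⟨⊤, by simp, fun h' => absurd h' h⟩
  choose θ hθ hθs using hex
  obtain ⟨e', heB, heb, hθe⟩ := exists_extend_realize e hb (Formula.iInf θ)
    (Formula.realize_iInf.2 hθ)
  have hψ : ∀ m', ψ.Realize (Sum.elim e' fun _ => m') ↔ ψ.Realize (Sum.elim e fun _ => m') := by
    intro m'
    refine realize_congr_freeVars ψ fun a ha => ?_
    rcases a with a | a
    · exact heB a (Or.inr ha)
    · rfl
  refine ⟨M, iM, hM, e', fun φ hφ => ?_⟩
  rcases hs hφ with (rfl | hφS) | hφd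
  · rw [realize_henkin, heb]
    simpa only [hψ] using hm
  · refine (realize_congr_freeVars φ fun a ha => ?_).2 (he φ (Or.inl hφS))
    exact heB a (Or.inl (Set.mem_biUnion hφS ha))
  · have hφθ : (inclExp L n).onFormula (θ ⟨φ, hφ⟩) = φ := hθs ⟨φ, hφ⟩ hφd
    rw [← hφθ]
    exact (LHom.realize_onFormula (inclExp L n) _).2 (Formula.realize_iInf.1 hθe ⟨φ, hφ⟩)

/-- Transfinite choice of witnesses `w` keeping a property of finite character. -/
theorem exists_witnesses {X Ψ W : Type u} {κ : Cardinal.{u}} (hκ : ℵ₀ ≤ κ) (hΨ : #Ψ ≤ κ)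
    [Nonempty W] (P : Set X → Prop) (hmono : ∀ S T, S ⊆ T → P T → P S)
    (hfin : ∀ S, (∀ s : Finset X, ↑s ⊆ S → P ↑s) → P S) (h : Ψ → W → X)
    (hstep : ∀ S : Set X, #S < κ → P S → ∀ ψ, ∃ b, P (insert (h ψ b) S))
    {S₀ : Set X} (hS₀ : #S₀ < κ) (hP : P S₀) :
    ∃ w : Ψ → W, P (S₀ ∪ range fun ψ => h ψ (w ψ)) := by
  classical
  obtain ⟨_, _, hord⟩ := exists_ord_eq_type_lt Ψ
  have hwf : WellFounded ((· < ·) : Ψ → Ψ → Prop) := wellFounded_lt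
  let w : Ψ → W := hwf.fix fun ψ ih =>
    Classical.epsilon fun b =>
      P (insert (h ψ b) (S₀ ∪ {x | ∃ ψ', ∃ hlt : ψ' < ψ, x = h ψ' (ih ψ' hlt)}))
  let seg : Ψ → Set X := fun ψ => S₀ ∪ (fun ψ' => h ψ' (w ψ')) '' Iio ψ
  have hw : ∀ ψ, w ψ = Classical.epsilon fun b => P (insert (h ψ b) (seg ψ)) := by
    intro ψ
    have : seg ψ = S₀ ∪ {x | ∃ ψ', ∃ _ : ψ' < ψ, x = h ψ' (w ψ')} := by
      ext x
      simp [seg, eq_comm]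
    rw [this]
    exact hwf.fix_eq _ ψ
  have hlim : ∀ D : Set Ψ, (∀ ψ ∈ D, P (insert (h ψ (w ψ)) (seg ψ))) →
      P (S₀ ∪ (fun ψ => h ψ (w ψ)) '' D) := by
    intro D hD
    refine hfin _ fun s hs => ?_
    obtain ⟨t, htD, hst⟩ : ∃ t : Finset Ψ, ↑t ⊆ D ∧
        (s : Set X) ⊆ S₀ ∪ (fun ψ => h ψ (w ψ)) '' (t : Set Ψ) := by
      have h1 : ((s.filter fun x => x ∉ S₀ : Finset X) : Set X) ⊆ (fun ψ => h ψ (w ψ)) '' D := by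
        intro x hx
        rw [Finset.coe_filter] at hx
        exact (hs hx.1).resolve_left hx.2
      obtain ⟨t, htD, ht⟩ := Finset.subset_set_image_iff.1 h1
      refine ⟨t, htD, fun x hx => ?_⟩
      by_cases hx0 : x ∈ S₀
      · exact Or.inl hx0
      · refine Or.inr ?_
        rw [← Finset.coe_image, ht]
        simpa using ⟨hx, hx0⟩
    rcases t.eq_empty_or_nonempty with rfl | hne
    · exact hmono _ _ (by simpa using hst) hP
    · obtain ⟨ψ, hψt, hmax⟩ := t.exists_max_image id hne
      refine hmono _ _ (hst.trans ?_) (hD ψ (htD hψt))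
      rintro x (hx | ⟨ψ', hψ', rfl⟩)
      · exact Or.inr (Or.inl hx)
      · rcases (hmax ψ' hψ').lt_or_eq with hlt | heq
        · exact Or.inr (Or.inr ⟨ψ', hlt, rfl⟩)
        · simp only [id] at heq
          subst heq
          exact Or.inl rfl
  have hall : ∀ ψ, P (insert (h ψ (w ψ)) (seg ψ)) := by
    intro ψ
    induction ψ using hwf.induction with
    | _ ψ ih =>
      have hseg : #(seg ψ) < κ := by
        refine (mk_union_le _ _).trans_lt (add_lt_of_lt hκ hS₀ (mk_image_le.trans_lt ?_))
        exact (mk_Iio_lt ψ hord).trans_le hΨ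
      have := hstep (seg ψ) hseg (hlim _ fun ψ' h' => ih ψ' h') ψ
      rw [hw]
      exact Classical.epsilon_spec this
  refine ⟨w, ?_⟩
  rw [← Set.image_univ]
  exact hlim univ fun ψ _ => hall ψ

/-- The set cut out on `U` by the new predicate of a structure `M`, along a map `e : U → M`. -/
def pullPred (L : FirstOrder.Language.{u, u}) {U M : Type u} {n : ℕ} [(expLang L n).Structure M]
    (e : U → M) : Set (Fin n → U) :=
  {a | @Structure.RelMap (expLang L n) M _ n (Sum.inr ⟨⟨rfl⟩⟩) (e ∘ a)}

/-- The map `e : U → M` is an embedding when it preserves all formulas of `L`. -/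
def pullEmbedding {L : FirstOrder.Language.{u, u}} {U M : Type u} [L.Structure U] {n : ℕ}
    [iM : (expLang L n).Structure M] (e : U → M)
    (he : ∀ φ ∈ expDiag L U n, φ.Realize e) :
    @Embedding (expLang L n) U M (expStr L U (pullPred L (n := n) e)) iM := by
  letI : L.Structure M := (inclExp L n).reduct M
  have hdiag : ∀ θ : L.Formula U, θ.Realize (id : U → U) → θ.Realize e := fun θ hθ =>
    (LHom.realize_onFormula (inclExp L n) θ).1 (he _ ⟨θ, hθ, rfl⟩)
  letI := expStr L U (pullPred L (n := n) e)
  refine ⟨⟨e, ?_⟩, ?_, ?_⟩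
  · intro x y hxy
    by_contra hne
    have := hdiag (Term.equal (Term.var x) (Term.var y)).not (by simpa using hne)
    simp [hxy] at this
  · intro k f x
    rcases f with f | f
    · have := hdiag (Term.equal (Term.func f fun i => Term.var (x i))
        (Term.var (Structure.funMap f x))) (by simp)
      have : Structure.funMap f (e ∘ x) = e (Structure.funMap f x) := by simpa using! this
      exact this.symm
    · exact f.elim
  · intro k R x
    rcases R with R | R
    · constructor
      · intro h
        by_contra hn
        have := hdiag (Formula.not (R.formula fun i => Term.var (x i))) (by
          simpa using! (show ¬Structure.RelMap (L := L) (M := U) R x from hn))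
        have : ¬Structure.RelMap (L := L) (M := M) R (e ∘ x) := by simpa using! this
        exact this h
      · intro h
        have := hdiag (R.formula fun i => Term.var (x i)) (by
          simpa using! (show Structure.RelMap (L := L) (M := U) R x from h))
        have : Structure.RelMap (L := L) (M := M) R (e ∘ x) := by simpa using! this
        exact this
    · obtain ⟨⟨rfl⟩⟩ := R
      rfl

/-- The expanded formula, with variables from `U`, that corresponds to a sentence with
parameters in `A`. -/
noncomputable def paramFormula {L' : FirstOrder.Language.{u, u}} {U : Type u} {A : Set U}
    (φ : (L'[[↥A]]).Sentence) : L'.Formula U :=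
  (Formula.equivSentence.symm φ).relabel Subtype.val

theorem realize_paramFormula {L' : FirstOrder.Language.{u, u}} {U : Type u} {A : Set U}
    (S : L'.Structure U) (φ : (L'[[↥A]]).Sentence) :
    (paramFormula φ).Realize (id : U → U) ↔ SentRealize U (addConsts U S A) φ := by
  rw [paramFormula, Formula.realize_relabel, Function.id_comp, Formula.realize_equivSentence_symm]
  rfl

theorem card_expLang_lt {L : FirstOrder.Language.{u, u}} {κ : Cardinal.{u}} (hκ : ℵ₀ < κ)
    (hL : L.card < κ) (n : ℕ) : (expLang L n).card < κ := by
  have h : (predLang n : FirstOrder.Language.{u, u}).card ≤ ℵ₀ := by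
    have : IsEmpty (Σ l, (predLang n : FirstOrder.Language.{u, u}).Functions l) :=
      ⟨fun x => x.2.elim⟩
    have : Countable (Σ l, (predLang n : FirstOrder.Language.{u, u}).Relations l) := by
      have : ∀ l, Countable ((predLang n : FirstOrder.Language.{u, u}).Relations l) := fun l =>
        inferInstanceAs (Countable (ULift (PLift (l = n))))
      infer_instance
    exact mk_le_aleph0_iff.2 (inferInstanceAs (Countable (_ ⊕ _)))
  rw [expLang, card_sum, Cardinal.lift_id, Cardinal.lift_id]
  exact add_lt_of_lt hκ.le hL (h.trans_lt hκ)

theorem mk_formula_le {L' : FirstOrder.Language.{u, u}} (α : Type u) :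
    #(L'.Formula α) ≤ max ℵ₀ (#α + L'.card) := by
  have h := BoundedFormula.card_le (L := L') (α := α)
  rw [Cardinal.lift_id, Cardinal.lift_id] at h
  exact (mk_le_of_injective (f := fun φ : L'.Formula α => (⟨0, φ⟩ : Σ k, L'.BoundedFormula α k))
    (sigma_mk_injective (i := 0))).trans h

theorem mk_sentence_lt {L' : FirstOrder.Language.{u, u}} {U : Type u} {κ : Cardinal.{u}}
    (hκ : ℵ₀ < κ) (hL : L'.card < κ) {A : Set U} (hA : #A < κ) :
    #((L'[[↥A]]).Sentence) < κ := by
  rw [← mk_congr (Formula.equivSentence (L := L') (α := ↥A))]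
  exact (mk_formula_le _).trans_lt (max_lt hκ (add_lt_of_lt hκ.le hA hL))

/-- A map from `U` that satisfies all Henkin formulas and preserves `L`-formulas is elementary. -/
theorem realize_pullPred {L : FirstOrder.Language.{u, u}} {U M : Type u} [L.Structure U] {n : ℕ}
    [iM : (expLang L n).Structure M] (e : U → M)
    (he : ∀ φ ∈ expDiag L U n, φ.Realize e)
    (hw : ∀ ψ : (expLang L n).Formula (U ⊕ Fin 1), ∃ b, (henkin ψ b).Realize e)
    (φ : (expLang L n).Formula U) :
    FRealize U (expStr L U (pullPred L e)) φ id ↔ φ.Realize e := by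
  let : (expLang L n).Structure U := expStr L U (pullPred L e)
  let f : U ↪[expLang L n] M := pullEmbedding e he
  have hf : ⇑f = e := rfl
  let F : U ↪ₑ[expLang L n] M := f.toElementaryEmbedding (by
    intro k φ x a ha
    let ψ : (expLang L n).Formula (U ⊕ Fin 1) :=
      φ.toFormula.relabel (Sum.elim Empty.elim (Fin.snoc (fun i => Sum.inl (x i)) (Sum.inr 0)))
    have hψ : ∀ m : M, ψ.Realize (Sum.elim e fun _ => m) ↔
        φ.Realize default (Fin.snoc (f ∘ x) m : Fin (k + 1) → M) := by
      intro m
      rw [Formula.realize_relabel, BoundedFormula.realize_toFormula]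
      refine iff_of_eq (congrArg₂ _ (Subsingleton.elim _ _) (funext fun i => ?_))
      refine Fin.lastCases ?_ (fun i => ?_) i <;> simp [hf]
    obtain ⟨b, hb⟩ := hw ψ
    exact ⟨b, (hψ _).1 ((realize_henkin ψ b e).1 hb ⟨a, (hψ a).2 ha⟩)⟩)
  exact (F.map_formula φ id).symm

/-- a finitely consistent set of sentences with one second-order variable
(for a subset of `U^n`) and parameters in a small set `A` has a solution `C ⊆ U^n`. -/
theorem stmt15 (L : FirstOrder.Language.{u, u}) (U : Type u) [iS : L.Structure U]
    (hsat : IsSatStr U iS) (hinacc : Cardinal.IsInaccessible #U) (hcard : L.card < #U)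
    (n : ℕ) (A : Set U) (hA : #A < #U)
    (p : Set (((expLang L n)[[↥A]]).Sentence))
    (hfc : ∀ s : Finset (((expLang L n)[[↥A]]).Sentence), ↑s ⊆ p →
      ∃ D : Set (Fin n → U), ∀ φ ∈ s, SentRealize U (addConsts U (expStr L U D) A) φ) :
    ∃ C : Set (Fin n → U), ∀ φ ∈ p, SentRealize U (addConsts U (expStr L U C) A) φ := by
  have hU : ℵ₀ < #U := hinacc.aleph0_lt
  have : Nonempty U := mk_ne_zero_iff.1 (aleph0_pos.trans hU).ne'
  have hL' : (expLang L n).card < #U := card_expLang_lt hU hcard n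
  have hfin : JointlySat (paramFormula '' p ∪ expDiag L U n) := by
    classical
    refine JointlySat.of_finite fun s hs => ?_
    have hsub : ((s.filter fun φ => φ ∉ expDiag L U n : Finset _) : Set _) ⊆ paramFormula '' p := by
      intro φ hφ
      rw [Finset.coe_filter] at hφ
      exact (hs hφ.1).resolve_right hφ.2
    obtain ⟨t, htp, ht⟩ := Finset.subset_set_image_iff.1 hsub
    obtain ⟨D, hD⟩ := hfc t htp
    refine ⟨U, expStr L U D, this, id, fun φ hφ => ?_⟩
    by_cases hφd : φ ∈ expDiag L U n
    · obtain ⟨θ, hθ, rfl⟩ := hφd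
      let := expStr L U D
      have : (inclExp L n).IsExpansionOn U := ⟨fun _ _ => rfl, fun _ _ => rfl⟩
      exact (LHom.realize_onFormula (inclExp L n) θ).2 hθ
    · have : φ ∈ t.image paramFormula := ht ▸ Finset.mem_filter.2 ⟨hφ, hφd⟩
      obtain ⟨χ, hχ, rfl⟩ := Finset.mem_image.1 this
      exact (realize_paramFormula _ χ).2 (hD χ hχ)
  obtain ⟨w, M, iM, hM, e, he⟩ := exists_witnesses (κ := #U)
    (Ψ := (expLang L n).Formula (U ⊕ Fin 1)) hU.le
    ((mk_formula_le _).trans (max_le hU.le (add_le_of_le hU.le (by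
      rw [mk_sum, Cardinal.lift_uzero, mk_fin, Cardinal.lift_natCast]
      exact add_le_of_le hU.le le_rfl ((natCast_lt_aleph0).le.trans hU.le)) hL'.le)))
    (fun S => JointlySat (S ∪ expDiag L U n))
    (fun S T hST hT => hT.mono (union_subset_union_left _ hST))
    (fun S hS => by
      classical
      refine JointlySat.of_finite fun s hs => ?_
      refine (hS (s.filter fun φ => φ ∈ S) (by simp [Set.subset_def])).mono fun φ hφ => ?_
      rcases hs hφ with h | h
      · exact Or.inl (by simpa using ⟨hφ, h⟩)
      · exact Or.inr h)
    henkin (fun S hS hP ψ => hsat.exists_henkin_witness hU hS hP ψ)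
    (mk_image_le.trans_lt ((mk_set_le p).trans_lt (mk_sentence_lt hU hL' hA))) hfin
  refine ⟨pullPred L e, fun φ hφ => ?_⟩
  rw [← realize_paramFormula]
  exact (realize_pullPred e (fun φ hφ => he φ (Or.inr hφ))
    (fun ψ => ⟨w ψ, he _ (Or.inl (Or.inr ⟨ψ, rfl⟩))⟩) _).2
    (he _ (Or.inl (Or.inl ⟨φ, hφ, rfl⟩)))

end Paper
end

section
/- If D ⊆ U^{|z|} is Lascar invariant over A, then for every formula φ(w) in the language with parameters from A and a predicate for D, the set φ(U) is pseudo-invariant over A, i.e., e(φ(U)) locally covers o(b/A) for every b ∈ φ(U). -/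
namespace Paper

open FirstOrder Language Cardinal Set

universe u

variable (L : FirstOrder.Language.{u, u}) (U : Type u) [iS : L.Structure U]

theorem comp_mem_imgSet {n : ℕ} (f : U ≃[L] U) (D : Set (Fin n → U)) (x : Fin n → U) :
    ⇑f ∘ x ∈ imgSet L U f D ↔ x ∈ D :=
  (f.injective.comp_left).mem_set_image

/-- An automorphism fixing `A` pointwise, as an isomorphism of `⟨U, D⟩` onto the expansion by the
image of `D`, both with constants for `A`. -/
def expEquiv {n : ℕ} {A : Set U} (D : Set (Fin n → U)) (f : U ≃[L] U) (hf : f ∈ AutFix L U A) :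
    @Language.Equiv ((expLang L n)[[↥A]]) U U (addConsts U (expStr L U D) A)
      (addConsts U (expStr L U (imgSet L U f D)) A) :=
  @Language.Equiv.mk _ U U (addConsts U (expStr L U D) A)
    (addConsts U (expStr L U (imgSet L U f D)) A) f.toEquiv
    (by
      rintro m (g | c) x
      · rcases g with g | g
        · exact f.map_fun' g x
        · exact g.elim
      · cases m with
        | zero => exact hf _ c.2
        | succ m => exact isEmptyElim c)
    (by
      rintro m (r | r) x
      · rcases r with r | r
        · exact f.map_rel' r x
        · exact comp_mem_imgSet L U f D _
      · exact isEmptyElim r)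

theorem fRealize_imgSet {n : ℕ} {A : Set U} (D : Set (Fin n → U)) {f : U ≃[L] U}
    (hf : f ∈ AutFix L U A) {α : Type*} (φ : ((expLang L n)[[↥A]]).Formula α) (v : α → U) :
    FRealize U (addConsts U (expStr L U (imgSet L U f D)) A) φ (⇑f ∘ v) ↔
      FRealize U (addConsts U (expStr L U D) A) φ v :=
  @StrongHomClass.realize_formula _ U U (addConsts U (expStr L U D) A)
    (addConsts U (expStr L U (imgSet L U f D)) A) α _
    (@Language.Equiv.instEquivLike _ U U (_) (_)) (@Language.Equiv.instStrongHomClass _ U U (_) (_))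
    (expEquiv L U D f hf) φ v

theorem imgSet_mem_eSet {n : ℕ} (D : Set (Fin n → U)) (f : U ≃[L] U) :
    imgSet L U f D ∈ eSet L U (∅ : Set U) D := by
  intro φ
  have h := fRealize_imgSet L U D (A := ∅) (f := f) (fun a ha => ha.elim) φ default
  rwa [Subsingleton.elim (⇑f ∘ default) default] at h

theorem fRealize_addConsts (A : Set U) {α : Type*} (φ : (L[[↥A]]).Formula α) (v : α → U) :
    FRealize U (addConsts U iS A) φ v ↔
      Formula.Realize (BoundedFormula.constantsVarsEquiv φ : L.Formula (↥A ⊕ α))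
        (Sum.elim Subtype.val v) := by
  let := addConsts U iS A
  have : (L.lhomWithConstants ↥A).IsExpansionOn U := ⟨fun _ _ => rfl, fun _ _ => rfl⟩
  exact (BoundedFormula.realize_constantsVarsEquiv (φ := φ) (v := v) (xs := default)).symm

/-- The image of an elementary substructure under an automorphism. -/
def mapElementary (M : L.ElementarySubstructure U) (f : U ≃[L] U) :
    L.ElementarySubstructure U where
  toSubstructure := (M : L.Substructure U).map f.toEmbedding.toHom
  isElementary' := by
    intro m φ x
    let e := f.toEmbedding.substructureEquivMap (M : L.Substructure U)
    have hx : (Subtype.val ∘ x : Fin m → U) = f ∘ (Subtype.val ∘ (e.symm ∘ x)) := by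
      funext i
      conv_lhs => rw [Function.comp_apply, ← e.apply_symm_apply (x i)]
      rfl
    rw [hx, StrongHomClass.realize_formula f φ, M.isElementary φ,
      StrongHomClass.realize_formula e.symm φ]

/-- `S ⊆ U × U` preserves the truth of all formulas between its two coordinates. -/
def PartElem (S : Set (U × U)) : Prop :=
  ∀ φ : L.Formula S, φ.Realize (fun p => p.1.1) ↔ φ.Realize (fun p => p.1.2)

variable {L U}

theorem PartElem.realize_iff {S : Set (U × U)} (hS : PartElem L U S) {α : Type*} {x y : α → U}
    (hxy : ∀ i, (x i, y i) ∈ S) (φ : L.Formula α) : φ.Realize x ↔ φ.Realize y := by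
  have h := hS (φ.relabel fun i => (⟨(x i, y i), hxy i⟩ : S))
  rwa [Formula.realize_relabel, Formula.realize_relabel] at h

theorem PartElem.eq_iff {S : Set (U × U)} (hS : PartElem L U S) {p q : U × U}
    (hp : p ∈ S) (hq : q ∈ S) : p.1 = q.1 ↔ p.2 = q.2 := by
  have := hS ((Term.var ⟨p, hp⟩).equal (Term.var ⟨q, hq⟩))
  simpa using this

theorem PartElem.swap {S : Set (U × U)} (hS : PartElem L U S) :
    PartElem L U (Prod.swap ⁻¹' S) := fun φ =>
  (hS.realize_iff (x := fun p : ↥(Prod.swap ⁻¹' S) => p.1.2) (fun p => p.2) φ).symm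

theorem PartElem.iUnion {ι : Type*} [Nonempty ι] {S : ι → Set (U × U)}
    (hd : Directed (· ⊆ ·) S) (hS : ∀ i, PartElem L U (S i)) : PartElem L U (⋃ i, S i) := by
  classical
  intro φ
  have hsub : (↑(φ.freeVarFinset.image Subtype.val) : Set (U × U)) ⊆ ⋃ i, S i := by
    intro p hp
    simp only [Finset.coe_image, Set.mem_image] at hp
    obtain ⟨q, -, rfl⟩ := hp
    exact q.2
  obtain ⟨i, hi⟩ := hd.exists_mem_subset_of_finset_subset_biUnion hsub
  let g : φ.freeVarFinset → S i := fun q => ⟨q.1.1, hi (Finset.mem_image_of_mem _ q.2)⟩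
  have h := hS i (BoundedFormula.restrictFreeVar φ g)
  rwa [Formula.Realize, Formula.Realize,
    BoundedFormula.realize_restrictFreeVar (f := g) (fun p => p.1.1) (fun _ => rfl),
    BoundedFormula.realize_restrictFreeVar (f := g) (fun p => p.1.2) (fun _ => rfl)] at h

theorem PartElem.exists_insert (hsat : IsSatStr U iS) {S : Set (U × U)} (hS : PartElem L U S)
    (hcard : #S < #U) (u : U) : ∃ v, PartElem L U (insert (u, v) S) := by
  classical
  have hσ : ∀ a : ↥(Prod.snd '' S), ∃ c, (c, a.1) ∈ S := by
    rintro ⟨_, ⟨c, a⟩, h, rfl⟩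
    exact ⟨c, h⟩
  choose σ hσ using hσ
  let p : Set ((L[[↥(Prod.snd '' S)]]).Formula (Fin 1)) :=
    {ψ | Formula.Realize (BoundedFormula.constantsVarsEquiv ψ : L.Formula (_ ⊕ Fin 1))
      (Sum.elim σ fun _ => u)}
  obtain ⟨b, hb⟩ := hsat (Prod.snd '' S) (mk_image_le.trans_lt hcard) 1 p (by
    intro s hs
    let χ : L.Formula (↥(Prod.snd '' S) ⊕ Fin 1) :=
      Formula.iInf fun ψ : s => BoundedFormula.constantsVarsEquiv ψ.1
    have hχ : (χ.iExs (Fin 1)).Realize σ :=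
      Formula.realize_iExs.2 ⟨fun _ => u, Formula.realize_iInf.2 fun ψ => hs ψ.2⟩
    obtain ⟨b, hb⟩ := Formula.realize_iExs.1 ((hS.realize_iff (y := Subtype.val) hσ _).1 hχ)
    refine ⟨b, fun ψ hψ => (fRealize_addConsts L U _ ψ b).2 ?_⟩
    exact Formula.realize_iInf.1 hb ⟨ψ, hψ⟩)
  have key : ∀ φ : L.Formula (↥(Prod.snd '' S) ⊕ Fin 1),
      φ.Realize (Sum.elim σ fun _ => u) → φ.Realize (Sum.elim Subtype.val b) := by
    intro φ hφ
    have h := (fRealize_addConsts L U _ (BoundedFormula.constantsVarsEquiv.symm φ) b).1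
      (hb _ (by simpa [p] using hφ))
    simpa using h
  refine ⟨b 0, fun φ => ?_⟩
  let g : ↥(insert (u, b 0) S) → ↥(Prod.snd '' S) ⊕ Fin 1 := fun q =>
    if h : q.1 ∈ S then Sum.inl ⟨q.1.2, q.1, h, rfl⟩ else Sum.inr 0
  have hg₁ : (Sum.elim σ fun _ => u) ∘ g = fun q => q.1.1 := by
    funext q
    by_cases h : q.1 ∈ S
    · simpa [g, h] using (hS.eq_iff (hσ ⟨q.1.2, q.1, h, rfl⟩) h).2 rfl
    · simp only [g, h, Function.comp_apply, dite_false, Sum.elim_inr]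
      rw [q.2.resolve_right h]
  have hg₂ : (Sum.elim Subtype.val b) ∘ g = fun q => q.1.2 := by
    funext q
    by_cases h : q.1 ∈ S
    · simp [g, h]
    · simp only [g, h, Function.comp_apply, dite_false, Sum.elim_inr]
      rw [q.2.resolve_right h]
  have h₁ := key (φ.relabel g)
  have h₂ := key (Formula.not (φ.relabel g))
  simp only [Formula.realize_not, Formula.realize_relabel, hg₁, hg₂] at h₁ h₂
  exact ⟨h₁, not_imp_not.1 h₂⟩

theorem PartElem.exists_extension (hsat : IsSatStr U iS) (hU : ℵ₀ ≤ #U) {S : Set (U × U)}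
    (hS : PartElem L U S) (hcard : #S < #U) (u : U) :
    ∃ T, S ⊆ T ∧ PartElem L U T ∧ #T < #U ∧ (∃ v, (u, v) ∈ T) ∧ ∃ v, (v, u) ∈ T := by
  have hins : ∀ (R : Set (U × U)) (q : U × U), #R < #U → #↥(insert q R) < #U := fun R q hR =>
    mk_insert_le.trans_lt (add_lt_of_lt hU hR (one_lt_aleph0.trans_le hU))
  obtain ⟨v, hv⟩ := hS.exists_insert hsat hcard u
  have hcv := hins S (u, v) hcard
  obtain ⟨w, hw⟩ := hv.swap.exists_insert hsat
    ((mk_preimage_of_injective _ _ Prod.swap_injective).trans_lt hcv) u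
  have hT : insert (w, u) (insert (u, v) S) =
      Prod.swap ⁻¹' insert (u, w) (Prod.swap ⁻¹' insert (u, v) S) := by
    ext ⟨a, b⟩
    simp [and_comm]
  exact ⟨insert (w, u) (insert (u, v) S), (subset_insert _ _).trans (subset_insert _ _),
    hT ▸ hw.swap, hins _ _ hcv, ⟨v, by simp⟩, ⟨w, by simp⟩⟩

/-- A partial elementary map that is total and surjective is an automorphism. -/
theorem PartElem.exists_equiv {S : Set (U × U)} (hS : PartElem L U S)
    (hdom : ∀ u, ∃ v, (u, v) ∈ S) (hran : ∀ u, ∃ v, (v, u) ∈ S) :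
    ∃ f : U ≃[L] U, ∀ p ∈ S, f p.1 = p.2 := by
  choose f hf using hdom
  choose g hg using hran
  refine ⟨{ toFun := f, invFun := g, left_inv := fun u => ?_, right_inv := fun u => ?_,
            map_fun' := fun {m} F x => ?_, map_rel' := fun {m} R x => ?_ }, fun p hp => ?_⟩
  · exact (hS.eq_iff (hg (f u)) (hf u)).2 rfl
  · exact (hS.eq_iff (hf (g u)) (hg u)).1 rfl
  · have h := hS.realize_iff (x := Fin.cons (Structure.funMap F x) x)
      (y := Fin.cons (f (Structure.funMap F x)) (f ∘ x))
      (Fin.cases (hf _) fun i => hf _) (Formula.graph F)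
    rw [Formula.realize_graph, Formula.realize_graph] at h
    exact (h.1 rfl).symm
  · have h := hS.realize_iff (x := x) (y := f ∘ x) (fun i => hf _)
      (R.formula fun i => Term.var i)
    simp only [Formula.realize_rel, Term.realize_var] at h
    exact h.symm
  · exact (hS.eq_iff (hf p.1) hp).1 rfl

/-- Homogeneity of saturated models: small partial elementary maps extend to automorphisms. -/
theorem PartElem.exists_equiv_of_isSatStr (hsat : IsSatStr U iS) (hreg : (#U).IsRegular)
    {S : Set (U × U)} (hS : PartElem L U S) (hcard : #S < #U) :
    ∃ f : U ≃[L] U, ∀ p ∈ S, f p.1 = p.2 := by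
  have hext : ∀ (R : Set (U × U)) (u : U), ∃ T, R ⊆ T ∧ (PartElem L U R → #R < #U →
      PartElem L U T ∧ #T < #U ∧ (∃ v, (u, v) ∈ T) ∧ ∃ v, (v, u) ∈ T) := by
    intro R u
    by_cases h : PartElem L U R ∧ #R < #U
    · obtain ⟨T, hT, h'⟩ := h.1.exists_extension hsat hreg.aleph0_le h.2 u
      exact ⟨T, hT, fun _ _ => h'⟩
    · exact ⟨R, subset_rfl, fun h₁ h₂ => (h ⟨h₁, h₂⟩).elim⟩
  choose G hGsub hG using hext
  obtain ⟨lo, wf, hord⟩ := exists_ord_eq_type_lt U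
  let H : U → Set (U × U) :=
    wf.wf.fix fun i ih => G (S ∪ ⋃ j : Iio i, ih j.1 j.2) i
  have hH : ∀ i, H i = G (S ∪ ⋃ j : Iio i, H j.1) i := fun i => wf.wf.fix_eq _ i
  have hSH : ∀ i, S ⊆ H i := fun i => by
    rw [hH]
    exact subset_union_left.trans (hGsub _ _)
  have hmono : Monotone H := by
    intro j i hji
    rcases hji.eq_or_lt with rfl | hlt
    · exact subset_rfl
    · rw [hH i]
      exact ((subset_iUnion (fun j : Iio i => H j.1) ⟨j, hlt⟩).trans subset_union_right).trans
        (hGsub _ _)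
  have hunion : ∀ J : Set U, (∀ j ∈ J, PartElem L U (H j)) →
      PartElem L U (S ∪ ⋃ j : J, H j.1) := by
    intro J hJ
    rcases J.eq_empty_or_nonempty with rfl | hne
    · simpa using hS
    · have := hne.to_subtype
      rw [union_eq_self_of_subset_left ((hSH _).trans
        (subset_iUnion (fun j : J => H j.1) (Classical.arbitrary J)))]
      exact PartElem.iUnion (fun i j =>
        (le_total i.1 j.1).elim (fun h => ⟨j, hmono h, subset_rfl⟩) fun h => ⟨i, subset_rfl, hmono h⟩)
        fun j => hJ _ j.2
  have hprop : ∀ i, PartElem L U (H i) ∧ #(H i) < #U ∧ (∃ v, (i, v) ∈ H i) ∧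
      ∃ v, (v, i) ∈ H i := by
    intro i
    induction i using wf.wf.induction with
    | _ i ih =>
      rw [hH i]
      refine hG _ i (hunion _ fun j hj => (ih j hj).1) ?_
      refine (mk_union_le _ _).trans_lt (add_lt_of_lt hreg.aleph0_le hcard ?_)
      exact (card_iUnion_lt_iff_forall_of_isRegular hreg (mk_Iio_lt i hord)).2
        fun j => (ih j.1 j.2).2.1
  have hsub : ∀ i, H i ⊆ S ∪ ⋃ j : (univ : Set U), H j.1 := fun i =>
    (subset_iUnion (fun j : (univ : Set U) => H j.1) ⟨i, mem_univ i⟩).trans subset_union_right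
  obtain ⟨f, hf⟩ := (hunion univ fun j _ => (hprop j).1).exists_equiv
    (fun i => (hprop i).2.2.1.imp fun v hv => hsub i hv)
    (fun i => (hprop i).2.2.2.imp fun v hv => hsub i hv)
  exact ⟨f, fun p hp => hf p (Or.inl hp)⟩

/-- Tuples with the same type over a small set `M` are conjugate over `M`. -/
theorem mem_oTuple_of_realize_iff (hsat : IsSatStr U iS) (hreg : (#U).IsRegular) {M : Set U}
    (hM : #M < #U) {k : ℕ} {a b : Fin k → U}
    (hab : ∀ φ : L.Formula (M ⊕ Fin k),
      φ.Realize (Sum.elim Subtype.val a) ↔ φ.Realize (Sum.elim Subtype.val b)) :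
    b ∈ oTuple L U M a := by
  let g : M ⊕ Fin k → U × U := Sum.elim (fun m => (m.1, m.1)) fun i => (a i, b i)
  have hS : PartElem L U (range g) := by
    intro φ
    choose r hr using fun q : range g => q.2
    have h₁ : (fun q : range g => q.1.1) = Sum.elim Subtype.val a ∘ r := by
      funext q
      rw [← hr q, Function.comp_apply]
      rcases r q with m | i <;> rfl
    have h₂ : (fun q : range g => q.1.2) = Sum.elim Subtype.val b ∘ r := by
      funext q
      rw [← hr q, Function.comp_apply]
      rcases r q with m | i <;> rfl
    rw [h₁, h₂, ← Formula.realize_relabel, ← Formula.realize_relabel]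
    exact hab _
  have hcard : #(range g) < #U := by
    refine mk_range_le.trans_lt ?_
    simp only [mk_sum, lift_uzero, mk_fin, lift_natCast]
    exact add_lt_of_lt hreg.aleph0_le hM ((natCast_lt_aleph0).trans_le hreg.aleph0_le)
  obtain ⟨f, hf⟩ := hS.exists_equiv_of_isSatStr hsat hreg hcard
  exact ⟨f, fun m hm => hf (m, m) ⟨Sum.inl ⟨m, hm⟩, rfl⟩,
    funext fun i => hf (a i, b i) ⟨Sum.inr i, rfl⟩⟩

/-- Among `#U` many `k`-tuples, `#U` many have the same type over a given small set. -/
theorem exists_large_oTuple (hsat : IsSatStr U iS) (hinacc : Cardinal.IsInaccessible #U)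
    (hcard : L.card < #U) {M : Set U} (hM : #M < #U) {k : ℕ} {K : Set (Fin k → U)}
    (hK : #K = #U) : ∃ a ∈ K, #U ≤ #↥(K ∩ oTuple L U M a) := by
  have hform : #(L.Formula (M ⊕ Fin k)) < #U := by
    have h₁ : #(L.Formula (M ⊕ Fin k)) ≤ #(Σ m, L.BoundedFormula (M ⊕ Fin k) m) :=
      mk_le_of_injective (f := fun φ => ⟨0, φ⟩) (sigma_mk_injective (i := 0))
    refine (h₁.trans BoundedFormula.card_le).trans_lt (max_lt hinacc.1 ?_)
    simp only [mk_sum, lift_id, lift_uzero, mk_fin, lift_natCast]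
    exact add_lt_of_lt hinacc.1.le
      (add_lt_of_lt hinacc.1.le hM (natCast_lt_aleph0.trans hinacc.1)) hcard
  obtain ⟨t, ht⟩ := infinite_pigeonhole_card
    (fun a : K => {φ : L.Formula (M ⊕ Fin k) | φ.Realize (Sum.elim Subtype.val a.1)}) #U hK.ge
    hinacc.1.le (by
      rw [hinacc.isRegular.cof_ord, mk_set]
      exact hinacc.isStrongLimit.isStrongPrelimit hform)
  obtain ⟨⟨a, ha⟩, rfl⟩ : ((fun a : K =>
      {φ : L.Formula (M ⊕ Fin k) | φ.Realize (Sum.elim Subtype.val a.1)}) ⁻¹' {t}).Nonempty := by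
    rw [← nonempty_coe_sort, ← mk_ne_zero_iff]
    exact (hinacc.pos.trans_le ht).ne'
  refine ⟨a, ha, ht.trans (mk_le_of_injective
    (f := fun c => ⟨c.1.1, c.1.2, ?_⟩) fun c d h => ?_)⟩
  · exact mem_oTuple_of_realize_iff hsat hinacc.isRegular hM fun φ =>
      (Set.ext_iff.1 c.2 φ).symm
  · exact Subtype.ext (Subtype.ext (congrArg (fun x => x.1) h))

variable (L U)

/-- if `D` is Lascar invariant over `A` then, for every formula `φ(w)` with
parameters in `A` and a predicate for `D`, the set `φ(U)` is pseudo-invariant over `A`. -/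
theorem stmt18 (L : FirstOrder.Language.{u, u}) (U : Type u) [iS : L.Structure U]
    (hsat : IsSatStr U iS) (hinacc : Cardinal.IsInaccessible #U) (hcard : L.card < #U)
    (hram : IsRamseyCard (#U))
    (n : ℕ) (A : Set U) (hA : #A < #U)
    (D : Set (Fin n → U)) (hD : LascarInv L U A D)
    (k : ℕ) (φ : ((expLang L n)[[↥A]]).Formula (Fin k)) :
    PseudoInv L U A
      {a : Fin k → U | FRealize U (addConsts U (expStr L U D) A) φ a} := by
  intro b hb K hK hKcard j
  obtain ⟨M, hAM, hM⟩ := exists_elementarySubstructure_card_eq L A (max ℵ₀ (max #A L.card))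
    (le_max_left _ _) (by simp) (by simp)
    (by simpa using ⟨hinacc.1.le, hA.le, hcard.le⟩)
  have hMcard : #(M : Set U) < #U := by
    rw [lift_id, lift_id] at hM
    exact hM.trans_lt (max_lt hinacc.1 (max_lt hA hcard))
  obtain ⟨a, ha, hlarge⟩ := exists_large_oTuple hsat hinacc hcard hMcard hKcard
  obtain ⟨g, hg, rfl⟩ := hK ha
  refine ⟨imgSet L U g _, imgSet_mem_eSet L U _ g, (natCast_lt_aleph0.trans hinacc.1).le.trans
    (hlarge.trans (mk_le_mk_of_subset ?_))⟩
  rintro _ ⟨hc, h, hh, rfl⟩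
  refine ⟨hc, ?_⟩
  let h' : U ≃[L] U := g.symm.comp (h.comp g)
  have hN : h' ∈ AutFix L U (mapElementary L U M g.symm : L.Substructure U) := by
    rintro _ ⟨m, hm, rfl⟩
    change g.symm (h (g (g.symm m))) = g.symm m
    rw [g.apply_symm_apply, hh m hm]
  have hA' : A ⊆ (mapElementary L U M g.symm : L.Substructure U) := fun x hx =>
    ⟨x, hAM hx, g.toEquiv.symm_apply_eq.2 (hg x hx).symm⟩
  have hDh : imgSet L U h' D = D :=
    hD _ hA' ((mk_image_le (f := g.symm) (s := (M : Set U))).trans_lt hMcard) h' hN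
  refine ⟨⇑h' ∘ b, ?_, ?_⟩
  · have := (fRealize_imgSet L U D (fun x hx => hN x (hA' hx)) φ b).2 hb
    rwa [hDh] at this
  · funext i
    exact g.apply_symm_apply _

end Paper
end
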